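/- Let G be an infinite, finitely-generated group with finite, symmetric generating set X, let ω be a radial weight on G with respect to X, and write τₙ for the value that ω takes on Sₙ. Then the augmentation ideal ℓ¹₀(G, ω) is finitely-generated as a left ideal of ℓ¹(G, ω) if and only if the sequence (τₙ) is tail-preserving. -/

import Mathlib

noncomputable section

open scoped BigOperators

variable {G : Type*}

/-- Convolution of two functions on a (discrete) group:
`(f ∗ g)(u) = ∑_{st = u} f(s) g(t)`. -/
def conv [Mul G] (f g : G → ℂ) : G → ℂ :=
  fun u => ∑' p : {p : G × G // p.1 * p.2 = u}, f (p : G × G).1 * g (p : G × G).2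

/-- The weighted space `ℓ¹(G, ω)`, as a set of functions `G → ℂ`. -/
def l1w (ω : G → ℝ) : Set (G → ℂ) := {f | Summable fun u => ‖f u‖ * ω u}

/-- The augmentation ideal `ℓ¹₀(G, ω) = {f ∈ ℓ¹(G, ω) : ∑_u f(u) = 0}`. -/
def l1w0 (ω : G → ℝ) : Set (G → ℂ) := {f ∈ l1w ω | ∑' u, f u = 0}

/-- `ω` is a weight on the group `G`. -/
def IsWeight [Monoid G] (ω : G → ℝ) : Prop :=
  (∀ u, 1 ≤ ω u) ∧ ω 1 = 1 ∧ ∀ u v, ω (u * v) ≤ ω u * ω v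

/-- `I` is finitely generated as a left ideal of `ℓ¹(G, ω)`:
`I = A♯x₁ + ⋯ + A♯xₙ` for some `x₁, …, xₙ ∈ A = ℓ¹(G, ω)`, where `A♯` is the
(conditional) unitisation, so `A♯x = {a ∗ x + c x : a ∈ A, c ∈ ℂ}`;
no closure is taken. -/
def IsFinGenLeftIdealOf [Mul G] (ω : G → ℝ) (I : Set (G → ℂ)) : Prop :=
  ∃ (n : ℕ) (x : Fin n → (G → ℂ)), (∀ i, x i ∈ l1w ω) ∧
    I = {f | ∃ (a : Fin n → (G → ℂ)) (c : Fin n → ℂ), (∀ i, a i ∈ l1w ω) ∧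
          f = ∑ i, (conv (a i) (x i) + c i • x i)}

/-- The word length of `u` with respect to a (symmetric) generating set `X`. -/
def wordLength [Monoid G] (X : Set G) (u : G) : ℕ :=
  sInf {n | ∃ l : List G, l.length = n ∧ (∀ x ∈ l, x ∈ X) ∧ l.prod = u}

/-- The tail `∑_{j=n+1}^∞ x_j` of a sequence, in 0-indexed form. -/
def tailFrom (x : ℕ → ℂ) (n : ℕ) : ℂ := ∑' j : ℕ, x (n + 1 + j)

/-- A sequence `τ` in `[1,∞)` is tail-preserving if for every complex sequence `x` with
`∑ τₙ|xₙ| < ∞` one has `∑ τₙ|∑_{j>n} x_j| < ∞`.  (0-indexed: `τ n` is the paper's `τ_{n+1}`.) -/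
def TailPreserving (τ : ℕ → ℝ) : Prop :=
  ∀ x : ℕ → ℂ, Summable (fun n => τ n * ‖x n‖) →
    Summable (fun n => τ n * ‖tailFrom x n‖)

section WL

lemma conv_apply [Group G] (f g : G → ℂ) (u : G) : conv f g u = ∑' s, f s * g (s⁻¹ * u) := by
  unfold conv
  let e : G ≃ {p : G × G // p.1 * p.2 = u} :=
    { toFun := fun s => ⟨(s, s⁻¹ * u), by simp⟩
      invFun := fun p => p.1.1
      left_inv := fun s => rfl
      right_inv := by
        rintro ⟨⟨a, b⟩, h⟩
        simp only [Subtype.mk.injEq, Prod.mk.injEq, true_and]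
        simp only at h
        rw [← h]; simp }
  rw [← e.tsum_eq]
  rfl

variable [Group G] {X : Finset G}

lemma exists_word (hXsym : ∀ x ∈ X, x⁻¹ ∈ X) (hXgen : Subgroup.closure (X : Set G) = ⊤) (u : G) :
    ∃ l : List G, (∀ x ∈ l, x ∈ (X : Set G)) ∧ l.prod = u := by
  have hu : u ∈ Subgroup.closure (X : Set G) := by rw [hXgen]; trivial
  rw [← Subgroup.mem_toSubmonoid, Subgroup.closure_toSubmonoid] at hu
  obtain ⟨l, hl, h⟩ := Submonoid.exists_list_of_mem_closure hu
  refine ⟨l, fun x hx => ?_, h⟩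
  rcases hl x hx with h1 | h1
  · exact h1
  · have := hXsym _ h1
    simpa using this

lemma wl_spec (hXsym : ∀ x ∈ X, x⁻¹ ∈ X) (hXgen : Subgroup.closure (X : Set G) = ⊤) (u : G) :
    ∃ l : List G, l.length = wordLength (X : Set G) u ∧ (∀ x ∈ l, x ∈ (X : Set G)) ∧ l.prod = u := by
  obtain ⟨l, h1, h2⟩ := exists_word hXsym hXgen u
  exact Nat.sInf_mem (s := {n | ∃ l : List G, l.length = n ∧ (∀ x ∈ l, x ∈ (X : Set G)) ∧ l.prod = u})
    ⟨l.length, l, rfl, h1, h2⟩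

lemma wl_le (l : List G) (h : ∀ x ∈ l, x ∈ (X : Set G)) : wordLength (X : Set G) l.prod ≤ l.length :=
  Nat.sInf_le ⟨l, rfl, h, rfl⟩

lemma wl_one : wordLength (X : Set G) (1 : G) = 0 := by
  have := wl_le (X := X) [] (by simp)
  simpa using this

lemma wl_mul_le (hXsym : ∀ x ∈ X, x⁻¹ ∈ X) (hXgen : Subgroup.closure (X : Set G) = ⊤) (u x : G)
    (hx : x ∈ X) : wordLength (X : Set G) (u * x) ≤ wordLength (X : Set G) u + 1 := by
  obtain ⟨l, h1, h2, h3⟩ := wl_spec hXsym hXgen u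
  have := wl_le (X := X) (l ++ [x]) (by
    intro y hy
    rcases List.mem_append.1 hy with hy | hy
    · exact h2 y hy
    · simp at hy; subst hy; exact hx)
  simpa [h1, h3] using this

lemma wl_le_mul (hXsym : ∀ x ∈ X, x⁻¹ ∈ X) (hXgen : Subgroup.closure (X : Set G) = ⊤) (u x : G)
    (hx : x ∈ X) : wordLength (X : Set G) u ≤ wordLength (X : Set G) (u * x) + 1 := by
  have := wl_mul_le hXsym hXgen (u * x) x⁻¹ (hXsym x hx)
  simpa using this

lemma wl_eq_zero (hXsym : ∀ x ∈ X, x⁻¹ ∈ X) (hXgen : Subgroup.closure (X : Set G) = ⊤) (u : G)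
    (h : wordLength (X : Set G) u = 0) : u = 1 := by
  obtain ⟨l, h1, h2, h3⟩ := wl_spec hXsym hXgen u
  rw [h, List.length_eq_zero_iff] at h1
  subst h1; simpa using h3.symm

lemma wl_parent (hXsym : ∀ x ∈ X, x⁻¹ ∈ X) (hXgen : Subgroup.closure (X : Set G) = ⊤) (u : G) (n : ℕ)
    (h : wordLength (X : Set G) u = n + 1) :
    ∃ v x, x ∈ X ∧ u = v * x ∧ wordLength (X : Set G) v = n := by
  obtain ⟨l, h1, h2, h3⟩ := wl_spec hXsym hXgen u
  rcases List.eq_nil_or_concat l with rfl | ⟨l', x, rfl⟩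
  · simp [h] at h1
  · have hx : x ∈ X := h2 x (by simp)
    have hp : u = l'.prod * x := by rw [← h3]; simp
    refine ⟨l'.prod, x, hx, hp, ?_⟩
    have h4 := wl_le (X := X) l' (fun y hy => h2 y (by simp [hy]))
    have h5 := wl_mul_le hXsym hXgen l'.prod x hx
    rw [← hp] at h5
    simp at h1
    omega

lemma wl_surj [Infinite G] (hXsym : ∀ x ∈ X, x⁻¹ ∈ X) (hXgen : Subgroup.closure (X : Set G) = ⊤)
    (n : ℕ) : ∃ u, wordLength (X : Set G) u = n := by
  have hfin : ∀ m, {u : G | wordLength (X : Set G) u ≤ m}.Finite := by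
    intro m
    induction m with
    | zero =>
      refine (Set.finite_singleton (1 : G)).subset fun u hu => ?_
      exact wl_eq_zero hXsym hXgen u (by simpa using hu)
    | succ m ih =>
      refine (ih.union (ih.mul X.finite_toSet)).subset fun u hu => ?_
      rcases Nat.lt_or_ge m (wordLength (X : Set G) u) with h | h
      · obtain ⟨v, x, hx, rfl, hv⟩ := wl_parent hXsym hXgen u m (le_antisymm hu h)
        exact Or.inr (Set.mul_mem_mul hv.le hx)
      · exact Or.inl h
  obtain ⟨u, hu⟩ := (hfin n).infinite_compl.nonempty
  have hu' : n < wordLength (X : Set G) u := by simpa using hu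
  obtain ⟨k, hk⟩ := Nat.exists_eq_add_of_lt hu'
  clear hu hu'
  induction k generalizing u with
  | zero =>
    obtain ⟨v, x, hx, -, hv⟩ := wl_parent hXsym hXgen u _ hk
    exact ⟨v, hv⟩
  | succ k ih =>
    obtain ⟨v, x, hx, -, hv⟩ := wl_parent hXsym hXgen u _ hk
    exact ih v (by omega)

end WL
section Pert

/-- unweighted ell-one -/
abbrev Ell (G : Type*) := lp (fun _ : G => ℂ) 1

lemma ell_summable (a : Ell G) : Summable fun w => ‖a w‖ := by
  have := (lp.memℓp a).summable (by simp)
  simpa using this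

lemma ell_norm (a : Ell G) : ‖a‖ = ∑' w, ‖a w‖ := by
  rw [lp.norm_eq_tsum_rpow (by simp)]
  simp

lemma ell_mem {f : G → ℂ} (h : Summable fun w => ‖f w‖) : Memℓp f 1 :=
  memℓp_gen (by simpa using h)

variable {F : Type*} [NormedAddCommGroup F] [NormedSpace ℂ F] [CompleteSpace F]

lemma summable_smul_bdd (a : Ell G) (k : G → F) (C : ℝ) (hk : ∀ w, ‖k w‖ ≤ C) :
    Summable fun w => ‖a w • k w‖ := by
  refine Summable.of_nonneg_of_le (fun _ => norm_nonneg _) (fun w => ?_)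
    ((ell_summable a).mul_right C)
  rw [norm_smul]
  exact mul_le_mul_of_nonneg_left (hk w) (norm_nonneg _)

lemma exists_op (k : G → F) (C : ℝ) (hC : 0 ≤ C) (hk : ∀ w, ‖k w‖ ≤ C) :
    ∃ T : Ell G →L[ℂ] F, ‖T‖ ≤ C ∧ ∀ a : Ell G, HasSum (fun w => a w • k w) (T a) := by
  have hs := fun a : Ell G => (summable_smul_bdd a k C hk)
  let T0 : Ell G →ₗ[ℂ] F :=
    { toFun := fun a => ∑' w, a w • k w
      map_add' := fun a b => by
        rw [← (hs a).of_norm.tsum_add (hs b).of_norm]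
        exact tsum_congr fun w => by rw [← add_smul]; rfl
      map_smul' := fun c a => by
        simp only [RingHom.id_apply]
        rw [← (hs a).of_norm.tsum_const_smul c]
        exact tsum_congr fun w => by rw [smul_smul]; rfl }
  have hb : ∀ a, ‖T0 a‖ ≤ C * ‖a‖ := by
    intro a
    refine (norm_tsum_le_tsum_norm (hs a)).trans ?_
    rw [ell_norm, ← tsum_mul_left]
    refine (hs a).tsum_le_tsum (fun w => ?_) ((ell_summable a).mul_left C)
    rw [norm_smul, mul_comm]
    exact mul_le_mul_of_nonneg_right (hk w) (norm_nonneg _)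
  exact ⟨T0.mkContinuous C hb, T0.mkContinuous_norm_le hC hb, fun a => (hs a).of_norm.hasSum⟩

/-- Surjectivity is stable under small perturbation. -/
lemma surj_pert {E : Type*} [NormedAddCommGroup E] [NormedSpace ℂ E] [CompleteSpace E]
    (T : E →L[ℂ] F) (hT : Function.Surjective T) :
    ∃ ε > 0, ∀ S : E →L[ℂ] F, ‖S - T‖ ≤ ε → Function.Surjective S := by
  have hr : T.range = ⊤ := LinearMap.range_eq_top.2 hT
  let R := T.nonlinearRightInverseOfSurjective hr
  have hR : 0 < R.nnnorm := T.nonlinearRightInverseOfSurjective_nnnorm_pos hr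
  refine ⟨(R.nnnorm : ℝ)⁻¹ / 2, by positivity, fun S hS f => ?_⟩
  have hA : ApproximatesLinearOn S T Set.univ (R.nnnorm⁻¹ / 2) := by
    intro x _ y _
    have : S x - S y - T (x - y) = (S - T) (x - y) := by simp
    rw [this]
    refine ((S - T).le_opNorm _).trans (mul_le_mul_of_nonneg_right ?_ (norm_nonneg _))
    simpa using hS
  have hp : 0 < (R.nnnorm : ℝ)⁻¹ / 2 := by positivity
  have h := hA.surjOn_closedBall_of_nonlinearRightInverse R
    (ε := ‖f‖ / ((R.nnnorm : ℝ)⁻¹ / 2)) (b := 0) (by positivity) (Set.subset_univ _)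
  obtain ⟨x, -, hx⟩ := h (show f ∈ _ by
    rw [map_zero, mem_closedBall_zero_iff]
    apply le_of_eq
    have : ((R.nnnorm : ℝ)⁻¹ - ((R.nnnorm⁻¹ / 2 : NNReal) : ℝ)) = (R.nnnorm : ℝ)⁻¹ / 2 := by
      push_cast; ring
    rw [this]
    field_simp)
  exact ⟨x, hx⟩

end Pert

section Trans

variable [Group G] {ω : G → ℝ}

lemma wpos (hω : IsWeight ω) (u : G) : 0 < ω u := lt_of_lt_of_le one_pos (hω.1 u)

lemma l1w_summable (hω : IsWeight ω) {f : G → ℂ} (hf : f ∈ l1w ω) : Summable fun u => ‖f u‖ :=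
  Summable.of_nonneg_of_le (fun _ => norm_nonneg _)
    (fun u => le_mul_of_one_le_right (norm_nonneg _) (hω.1 u)) hf

/-- the augmentation ideal inside ell-one (after rescaling) -/
def Aug (ω : G → ℝ) : Submodule ℂ (Ell G) where
  carrier := {f | HasSum (fun u => f u / ω u) 0}
  add_mem' := fun {a b} ha hb => by
    have := HasSum.add ha hb
    rw [add_zero] at this
    refine this.congr_fun fun u => ?_
    rw [← add_div]; rfl
  zero_mem' := by
    show HasSum (fun u => ((0 : Ell G) u) / (ω u : ℂ)) 0
    simpa using (hasSum_zero : HasSum (fun _ : G => (0 : ℂ)) 0)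
  smul_mem' := fun c a ha => by
    have := HasSum.mul_left c ha
    rw [mul_zero] at this
    refine this.congr_fun fun u => ?_
    rw [← mul_div_assoc]; rfl

lemma aug_closed (hω : IsWeight ω) : IsClosed (Aug ω : Set (Ell G)) := by
  obtain ⟨T, -, hT⟩ := exists_op (F := ℂ) (fun w => (ω w : ℂ)⁻¹) 1 zero_le_one (fun w => by
    rw [norm_inv, Complex.norm_real, Real.norm_of_nonneg (wpos hω w).le]
    exact inv_le_one_of_one_le₀ (hω.1 w))
  have : (Aug ω : Set (Ell G)) = T ⁻¹' {0} := by
    ext f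
    have h := hT f
    simp only [smul_eq_mul, ← div_eq_mul_inv] at h
    constructor
    · intro hf
      exact HasSum.unique h hf
    · intro hf
      have hf : T f = 0 := hf
      rw [hf] at h
      exact h
  rw [this]
  exact isClosed_singleton.preimage T.continuous

lemma kfun_summable (hω : IsWeight ω) {x : G → ℂ} (hx : x ∈ l1w ω) (w : G) :
    Summable (fun u => ‖(ω u : ℂ) * x (w⁻¹ * u) / ω w‖) ∧
    ∑' u, ‖(ω u : ℂ) * x (w⁻¹ * u) / ω w‖ ≤ ∑' u, ‖x u‖ * ω u := by
  have hx : Summable fun u => ‖x u‖ * ω u := hx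
  have key : ∀ s, ‖(ω (w * s) : ℂ) * x (w⁻¹ * (w * s)) / ω w‖ ≤ ‖x s‖ * ω s := by
    intro s
    rw [norm_div, norm_mul, Complex.norm_real, Complex.norm_real,
      Real.norm_of_nonneg (wpos hω w).le, Real.norm_of_nonneg (wpos hω _).le,
      div_le_iff₀ (wpos hω w), inv_mul_cancel_left]
    have := mul_le_mul_of_nonneg_right (hω.2.2 w s) (norm_nonneg (x s))
    linarith
  have hs : Summable (fun s => ‖(ω (w * s) : ℂ) * x (w⁻¹ * (w * s)) / ω w‖) :=
    Summable.of_nonneg_of_le (fun _ => norm_nonneg _) key hx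
  constructor
  · exact (Equiv.mulLeft w).summable_iff.1 hs
  · rw [← (Equiv.mulLeft w).tsum_eq]
    exact hs.tsum_le_tsum key hx

lemma exists_k (hω : IsWeight ω) {x : G → ℂ} (hx : x ∈ l1w0 ω) :
    ∃ k : G → Aug ω, (∀ w, ‖k w‖ ≤ ∑' u, ‖x u‖ * ω u) ∧
      ∀ w u, ((k w : Ell G) : G → ℂ) u = (ω u : ℂ) * x (w⁻¹ * u) / ω w := by
  have h := kfun_summable hω hx.1
  refine ⟨fun w => ⟨⟨_, ell_mem (h w).1⟩, ?_⟩, fun w => ?_, fun w u => rfl⟩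
  · show HasSum (fun u => ((ω u : ℂ) * x (w⁻¹ * u) / ω w) / ω u) 0
    have h1 : HasSum x 0 := by
      rw [← hx.2]; exact (l1w_summable hω hx.1).of_norm.hasSum
    have h2 : HasSum (fun u => x (w⁻¹ * u)) 0 := (Equiv.mulLeft w⁻¹).hasSum_iff.2 h1
    have h3 := h2.mul_left ((ω w : ℂ)⁻¹)
    rw [mul_zero] at h3
    refine h3.congr_fun fun u => ?_
    have := wpos hω u
    have h5 : (ω u : ℂ) ≠ 0 := by exact_mod_cast (wpos hω u).ne'
    field_simp
  · refine le_trans (le_of_eq ?_) (h w).2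
    exact ell_norm _

end Trans
section FG

variable [Group G] {ω : G → ℝ}

lemma fin_l1w {y : G → ℂ} (hy : y.support.Finite) : y ∈ l1w ω := by
  refine summable_of_hasFiniteSupport (hy.subset ?_)
  intro u hu
  rw [Function.mem_support] at hu ⊢
  intro h
  apply hu
  simp [h]

lemma l1w_sub (hω : IsWeight ω) {x y : G → ℂ} (hx : x ∈ l1w ω) (hy : y ∈ l1w ω) :
    x - y ∈ l1w ω := by
  refine Summable.of_nonneg_of_le (fun u => mul_nonneg (norm_nonneg _) (wpos hω u).le)
    (fun u => ?_) (Summable.add hx hy)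
  rw [← add_mul]
  exact mul_le_mul_of_nonneg_right (norm_sub_le _ _) (wpos hω u).le

lemma l1w0_sub (hω : IsWeight ω) {x y : G → ℂ} (hx : x ∈ l1w0 ω) (hy : y ∈ l1w0 ω) :
    x - y ∈ l1w0 ω := by
  refine ⟨l1w_sub hω hx.1 hy.1, ?_⟩
  have := (l1w_summable hω hx.1).of_norm.tsum_sub (l1w_summable hω hy.1).of_norm
  rw [hx.2, hy.2, sub_zero] at this
  exact this

lemma approx (hω : IsWeight ω) {x : G → ℂ} (hx : x ∈ l1w0 ω) {ε : ℝ} (hε : 0 < ε) :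
    ∃ y ∈ l1w0 ω, y.support.Finite ∧ ∑' u, ‖(x - y) u‖ * ω u ≤ ε := by
  classical
  have hxs : Summable fun u => ‖x u‖ * ω u := hx.1
  have hnn : ∀ u, 0 ≤ ‖x u‖ * ω u := fun u => mul_nonneg (norm_nonneg _) (wpos hω u).le
  obtain ⟨s, hs⟩ := ((tendsto_order.1 (tendsto_tsum_compl_atTop_zero
    (fun u => ‖x u‖ * ω u))).2 (ε / 2) (by positivity)).exists
  have hxn := (l1w_summable hω hx.1)
  set c : ℂ := ∑ u ∈ s, x u with hc
  have hcn : ‖c‖ ≤ ε / 2 := by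
    have h1 := hxn.of_norm.sum_add_tsum_subtype_compl s
    rw [hx.2] at h1
    have h2 : c = -∑' u : {u // u ∉ s}, x u := by
      rw [hc]; linear_combination h1
    rw [h2, norm_neg]
    have h3 : Summable fun u : {u // u ∉ s} => ‖x u‖ := hxn.subtype _
    refine (norm_tsum_le_tsum_norm h3).trans (le_trans ?_ hs.le)
    exact h3.tsum_le_tsum (fun u => le_mul_of_one_le_right (norm_nonneg _) (hω.1 u))
      (hxs.subtype _)
  let y : G → ℂ := fun u => (if u ∈ s then x u else 0) - (if u = 1 then c else 0)
  have hyf : y.support.Finite := by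
    refine (s.finite_toSet.union (Set.finite_singleton 1)).subset fun u hu => ?_
    by_contra h
    simp only [Set.mem_union, SetLike.mem_coe, Set.mem_singleton_iff, not_or] at h
    exact hu (by simp [y, h])
  have hy : HasSum y 0 := by
    have h1 : HasSum (fun u => if u ∈ s then x u else 0) c := by
      have : HasSum (fun u => if u ∈ s then x u else 0) (∑ u ∈ s, if u ∈ s then x u else 0) :=
        hasSum_sum_of_ne_finset_zero (fun b hb => by simp [hb])
      convert this using 1
      exact Finset.sum_congr rfl fun u hu => by simp [hu]
    have h2 : HasSum (fun u : G => if u = 1 then c else 0) c := hasSum_ite_eq 1 c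
    simpa using h1.sub h2
  have hyl : y ∈ l1w0 ω := ⟨fin_l1w hyf, hy.tsum_eq⟩
  refine ⟨y, hyl, hyf, ?_⟩
  have e1 : Summable fun u => (if u ∈ s then 0 else ‖x u‖ * ω u) :=
    Summable.of_nonneg_of_le (fun u => by split_ifs <;> simp [hnn u])
      (fun u => by split_ifs <;> simp [hnn u]) hxs
  have e2 : HasSum (fun u : G => if u = 1 then ‖c‖ else 0) ‖c‖ := hasSum_ite_eq 1 _
  have e3 : ∑' u, (if u ∈ s then 0 else ‖x u‖ * ω u) = ∑' u : {u // u ∉ s}, ‖x u‖ * ω u := by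
    have : (∑' u : ((s : Set G)ᶜ : Set G), ‖x u‖ * ω u) = _ :=
      tsum_subtype ((s : Set G)ᶜ) (fun u => ‖x u‖ * ω u)
    refine Eq.trans ?_ this.symm
    refine tsum_congr fun u => ?_
    by_cases h : u ∈ s <;> simp [h, Set.indicator]
  calc ∑' u, ‖(x - y) u‖ * ω u
      ≤ ∑' u, ((if u ∈ s then 0 else ‖x u‖ * ω u) + (if u = 1 then ‖c‖ else 0)) := by
        refine Summable.tsum_le_tsum (fun u => ?_) (l1w_sub hω hx.1 hyl.1) (e1.add e2.summable)
        simp only [Pi.sub_apply, y]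
        have h0 := wpos hω u
        by_cases h1 : u = 1
        · subst h1
          rw [hω.2.1]
          by_cases h2 : (1 : G) ∈ s
          · simp [h2]
          · simp only [h2, if_false, if_true, mul_one, zero_sub, sub_neg_eq_add]
            exact norm_add_le _ _
        · by_cases h2 : u ∈ s <;> simp [h1, h2]
    _ = (∑' u, if u ∈ s then 0 else ‖x u‖ * ω u) + ‖c‖ := by
        rw [e1.tsum_add e2.summable, e2.tsum_eq]
    _ ≤ ε := by rw [e3]; linarith

lemma conv_summable (hω : IsWeight ω) {a x : G → ℂ} (ha : a ∈ l1w ω) (hx : x ∈ l1w ω) (u : G) :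
    Summable fun s => a s * x (s⁻¹ * u) := by
  have h1 := l1w_summable hω ha
  have h2 := l1w_summable hω hx
  refine Summable.of_norm_bounded (h1.mul_right (∑' t, ‖x t‖)) fun s => ?_
  rw [norm_mul]
  exact mul_le_mul_of_nonneg_left (h2.le_tsum _ (fun _ _ => norm_nonneg _)) (norm_nonneg _)

lemma fg_fin (hω : IsWeight ω) (h : IsFinGenLeftIdealOf ω (l1w0 ω)) :
    ∃ (n : ℕ) (y : Fin n → G → ℂ), (∀ i, y i ∈ l1w0 ω) ∧ (∀ i, (y i).support.Finite) ∧
      ∀ f ∈ l1w0 ω, ∃ a : Fin n → G → ℂ, (∀ i, a i ∈ l1w ω) ∧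
        ∀ u, f u = ∑ i, ∑' s, a i s * y i (s⁻¹ * u) := by
  classical
  obtain ⟨n, x, hx, hI⟩ := h
  have hx0 : ∀ i, x i ∈ l1w0 ω := by
    intro i
    rw [hI]
    refine ⟨fun _ => 0, Pi.single i 1, fun _ => fin_l1w (by simp), ?_⟩
    have : ∀ j, conv (0 : G → ℂ) (x j) = 0 := by
      intro j; ext u; rw [conv_apply]; simp
    simp [this, Pi.single_apply]
  have : CompleteSpace (Aug ω) := (aug_closed hω).completeSpace_coe
  have hC : ∀ z : G → ℂ, 0 ≤ ∑' u, ‖z u‖ * ω u := fun z =>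
    tsum_nonneg fun u => mul_nonneg (norm_nonneg _) (wpos hω u).le
  -- the operator attached to a family of generators
  have hop : ∀ z : G → ℂ, z ∈ l1w0 ω → ∃ T : Ell G →L[ℂ] Aug ω, ‖T‖ ≤ ∑' u, ‖z u‖ * ω u ∧
      ∀ (a : Ell G) u, HasSum (fun w => a w * ((ω u : ℂ) * z (w⁻¹ * u) / ω w))
        (((T a : Aug ω) : Ell G) u) := by
    intro z hz
    obtain ⟨k, hk1, hk2⟩ := exists_k hω hz
    obtain ⟨T, hT1, hT2⟩ := exists_op k _ (hC z) hk1
    refine ⟨T, hT1, fun a u => ?_⟩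
    let ev : Ell G →L[ℂ] ℂ := lp.evalCLM ℂ (fun _ : G => ℂ) 1 u
    have := ((ev.comp (Aug ω).subtypeL).hasSum (hT2 a))
    refine this.congr_fun fun w => ?_
    rw [← hk2]
    simp [ev]
    exact Or.inl rfl
  choose! Op hOp1 hOp2 using hop
  let Tot : (Fin n → G → ℂ) → ((Fin n → Ell G) →L[ℂ] Aug ω) := fun z =>
    ∑ i, (Op (z i)).comp (ContinuousLinearMap.proj i)
  have hTot : ∀ z, (∀ i, z i ∈ l1w0 ω) → ∀ a u, (((Tot z a : Aug ω) : Ell G) u) =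
      ω u * ∑ i, ∑' w, (a i w / ω w) * z i (w⁻¹ * u) := by
    intro z hz a u
    have : (((Tot z a : Aug ω) : Ell G) u) = ∑ i, (((Op (z i) (a i) : Aug ω) : Ell G) u) := by
      have e : Tot z a = ∑ i, Op (z i) (a i) := by simp [Tot]
      let ev : Aug ω →L[ℂ] ℂ := (lp.evalCLM ℂ (fun _ : G => ℂ) 1 u).comp (Aug ω).subtypeL
      exact (congrArg ev e).trans (map_sum ev _ _)
    rw [this, Finset.mul_sum]
    refine Finset.sum_congr rfl fun i _ => ?_
    rw [← (hOp2 (z i) (hz i) (a i) u).tsum_eq, ← tsum_mul_left]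
    exact tsum_congr fun w => by ring
  have hω0 : ∀ u, (ω u : ℂ) ≠ 0 := fun u => by exact_mod_cast (wpos hω u).ne'
  have hωn : ∀ u, ‖(ω u : ℂ)‖ = ω u := fun u => by
    rw [Complex.norm_real, Real.norm_of_nonneg (wpos hω u).le]
  have hsurj : Function.Surjective (Tot x) := by
    intro F
    let f : G → ℂ := fun u => (F : Ell G) u / ω u
    have hf : f ∈ l1w0 ω := by
      refine ⟨?_, HasSum.tsum_eq F.2⟩
      refine (ell_summable (F : Ell G)).congr fun u => ?_
      simp only [f, norm_div, hωn]
      rw [div_mul_cancel₀ _ (wpos hω u).ne']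
    rw [hI] at hf
    obtain ⟨a, c, ha, hfa⟩ := hf
    let δ : G → ℂ := fun u => if u = 1 then 1 else 0
    let b : Fin n → G → ℂ := fun i u => a i u + c i * δ u
    have hδ : ∀ i, (fun u => c i * δ u) ∈ l1w ω := fun i => by
      refine fin_l1w ((Set.finite_singleton (1 : G)).subset fun u hu => ?_)
      by_contra h
      have h : u ≠ 1 := h
      exact hu (by simp [δ, h])
    have hb : ∀ i, Summable fun u => ‖(ω u : ℂ) * b i u‖ := fun i => by
      refine Summable.of_nonneg_of_le (fun _ => norm_nonneg _) (fun u => ?_)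
        (Summable.add (ha i) (hδ i))
      rw [norm_mul, hωn, ← add_mul, mul_comm]
      exact mul_le_mul_of_nonneg_right (norm_add_le _ _) (wpos hω u).le
    refine ⟨fun i => ⟨_, ell_mem (hb i)⟩, ?_⟩
    apply Subtype.ext
    apply lp.ext
    funext u
    rw [hTot x hx0]
    have h1 : (F : Ell G) u = ω u * f u := by
      simp only [f]; rw [mul_div_cancel₀ _ (hω0 u)]
    rw [h1, hfa]
    congr 1
    rw [Finset.sum_apply]
    refine Finset.sum_congr rfl fun i _ => ?_
    rw [Pi.add_apply, conv_apply, Pi.smul_apply, smul_eq_mul]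
    have h2 : HasSum (fun s => (c i * δ s) * x i (s⁻¹ * u)) (c i * x i u) := by
      have := hasSum_ite_eq (1 : G) (c i * x i u)
      refine this.congr_fun fun s => ?_
      by_cases hs : s = 1 <;> simp [δ, hs]
    rw [← h2.tsum_eq, ← (conv_summable hω (ha i) (hx i) u).tsum_add h2.summable]
    refine tsum_congr fun w => ?_
    show (ω w : ℂ) * b i w / ω w * _ = _
    rw [mul_div_cancel_left₀ _ (hω0 w)]
    simp only [b]; ring
  obtain ⟨ε, hε, hS⟩ := surj_pert (Tot x) hsurj
  have hε' : 0 < ε / (n + 1) := by positivity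
  choose y hy1 hy2 hy3 using fun i => approx hω (hx0 i) hε'
  have hsurj2 : Function.Surjective (Tot y) := by
    apply hS
    have hdiff : Tot y - Tot x = -Tot (fun i => x i - y i) := by
      ext a u
      have hs : ∀ (i : Fin n) (z : G → ℂ), z ∈ l1w0 ω →
          Summable fun w => (a i w / ω w) * z (w⁻¹ * u) := fun i z hz => by
        refine conv_summable hω (a := fun w => a i w / ω w) ?_ hz.1 u
        refine (ell_summable (a i)).congr fun u => ?_
        simp only [norm_div, hωn]
        rw [div_mul_cancel₀ _ (wpos hω u).ne']
      have e1 := hTot y hy1 a u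
      have e2 := hTot x hx0 a u
      have e3 := hTot (fun i => x i - y i) (fun i => l1w0_sub hω (hx0 i) (hy1 i)) a u
      have : ((((Tot y - Tot x) a : Aug ω) : Ell G) u) =
        ((Tot y a : Aug ω) : Ell G) u - ((Tot x a : Aug ω) : Ell G) u := rfl
      rw [this]
      have : ((((-Tot (fun i => x i - y i)) a : Aug ω) : Ell G) u) =
        - (((Tot (fun i => x i - y i)) a : Aug ω) : Ell G) u := rfl
      rw [this, e1, e2, e3, ← mul_sub, ← mul_neg, ← Finset.sum_sub_distrib,
        ← Finset.sum_neg_distrib]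
      congr 1
      refine Finset.sum_congr rfl fun i _ => ?_
      rw [← (hs i _ (hy1 i)).tsum_sub (hs i _ (hx0 i)), ← tsum_neg]
      refine tsum_congr fun w => ?_
      simp only [Pi.sub_apply]; ring
    rw [hdiff]
    refine ContinuousLinearMap.opNorm_le_bound _ hε.le fun a => ?_
    rw [show (-Tot (fun i => x i - y i)) a = -(Tot (fun i => x i - y i) a) from rfl, norm_neg]
    have : Tot (fun i => x i - y i) a = ∑ i, Op (x i - y i) (a i) := by
      simp [Tot]
    rw [this]
    calc _ ≤ ∑ i, ‖Op (x i - y i) (a i)‖ := norm_sum_le _ _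
      _ ≤ ∑ i : Fin n, (ε / (n + 1)) * ‖a‖ := by
        refine Finset.sum_le_sum fun i _ => ?_
        refine ((Op (x i - y i)).le_opNorm _).trans ?_
        refine mul_le_mul ?_ (norm_le_pi_norm a i) (norm_nonneg _) hε'.le
        exact (hOp1 _ (l1w0_sub hω (hx0 i) (hy1 i))).trans (hy3 i)
      _ = (n * (ε / (n + 1))) * ‖a‖ := by simp [mul_assoc]
      _ ≤ ε * ‖a‖ := by
        refine mul_le_mul_of_nonneg_right ?_ (norm_nonneg _)
        rw [mul_div_assoc', div_le_iff₀ (by positivity)]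
        nlinarith
  refine ⟨n, y, hy1, hy2, fun f hf => ?_⟩
  have hfs : Summable fun u => ‖(ω u : ℂ) * f u‖ := by
    refine Summable.congr hf.1 fun u => ?_
    rw [norm_mul, hωn, mul_comm]
  let F : Aug ω := ⟨⟨_, ell_mem hfs⟩, by
    show HasSum (fun u => (ω u : ℂ) * f u / ω u) 0
    have h1 : HasSum f 0 := by rw [← hf.2]; exact (l1w_summable hω hf.1).of_norm.hasSum
    refine h1.congr_fun fun u => ?_
    rw [mul_div_cancel_left₀ _ (hω0 u)]⟩
  obtain ⟨A, hA⟩ := hsurj2 F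
  refine ⟨fun i w => A i w / ω w, fun i => ?_, fun u => ?_⟩
  · refine (ell_summable (A i)).congr fun u => ?_
    simp only [norm_div, hωn]
    rw [div_mul_cancel₀ _ (wpos hω u).ne']
  · have h1 := hTot y hy1 A u
    rw [hA] at h1
    have h2 : (ω u : ℂ) * f u = _ := h1
    exact mul_left_cancel₀ (hω0 u) h2

end FG
section Fwd

open scoped ENNReal

lemma summable_iff_enn {ι : Type*} {f : ι → ℝ} (hf : ∀ i, 0 ≤ f i) :
    Summable f ↔ ∑' i, ENNReal.ofReal (f i) ≠ ⊤ := by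
  constructor
  · exact fun h => h.tsum_ofReal_ne_top
  · intro h
    have := ENNReal.summable_toReal h
    simpa [ENNReal.toReal_ofReal, hf] using this

lemma ofReal_norm_mul (z : ℂ) {r : ℝ} :
    ENNReal.ofReal (‖z‖ * r) = ‖z‖ₑ * ENNReal.ofReal r := by
  rw [ENNReal.ofReal_mul (norm_nonneg _), ofReal_norm]

variable [Group G] {X : Finset G} {ω : G → ℝ} {τ : ℕ → ℝ}

/-- indicator of the complement of a ball -/
def phi (X : Finset G) (n : ℕ) (v : G) : ℂ := if n + 1 < wordLength (X : Set G) v then 1 else 0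

lemma phi_norm_le (n : ℕ) (v : G) : ‖phi X n v‖ ≤ 1 := by
  unfold phi; split_ifs <;> simp

/-- weighted variation -/
def vari (X : Finset G) (τ : ℕ → ℝ) (w v : G) : ℝ≥0∞ :=
  ∑' n, ENNReal.ofReal (τ n) * ‖phi X n (w * v) - phi X n w‖ₑ

lemma vari_bound (hXsym : ∀ x ∈ X, x⁻¹ ∈ X) (hXgen : Subgroup.closure (X : Set G) = ⊤)
    (hω : IsWeight ω)
    (hτ : ∀ (n : ℕ) (u : G), wordLength (X : Set G) u = n + 1 → τ n = ω u) (v : G) :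
    ∃ K : ℝ≥0∞, K ≠ ⊤ ∧ ∀ w, vari X τ w v ≤ K * ENNReal.ofReal (ω w) := by
  have hv : v ∈ Subgroup.closure (X : Set G) := by rw [hXgen]; trivial
  induction hv using Subgroup.closure_induction with
  | mem x hx =>
    refine ⟨ENNReal.ofReal (ω x), ENNReal.ofReal_ne_top, fun w => ?_⟩
    rw [← ENNReal.ofReal_mul (wpos hω x).le]
    set m := min (wordLength (X : Set G) w) (wordLength (X : Set G) (w * x)) - 1 with hm
    rw [← tsum_ite_eq m (fun _ => ENNReal.ofReal (ω x * ω w))]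
    refine ENNReal.tsum_le_tsum fun n => ?_
    have h1 := wl_mul_le hXsym hXgen w x hx
    have h2 := wl_le_mul hXsym hXgen w x hx
    by_cases hA : n + 1 < wordLength (X : Set G) (w * x) <;>
      by_cases hB : n + 1 < wordLength (X : Set G) w
    · simp [phi, hA, hB]
    · have e : n = m := by omega
      rw [if_pos e]
      simp only [phi, hA, hB, if_true, if_false, sub_zero, enorm_one, mul_one]
      apply ENNReal.ofReal_le_ofReal
      rw [hτ n w (by omega)]
      exact le_mul_of_one_le_left (wpos hω w).le (hω.1 x)
    · have e : n = m := by omega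
      rw [if_pos e]
      simp only [phi, hA, hB, if_true, if_false, zero_sub, enorm_neg, enorm_one, mul_one]
      apply ENNReal.ofReal_le_ofReal
      rw [hτ n (w * x) (by omega), mul_comm]
      exact hω.2.2 w x
    · simp [phi, hA, hB]
  | one => exact ⟨0, by simp, fun w => by simp [vari]⟩
  | mul x y _ _ hx hy =>
    obtain ⟨K, hK, h1⟩ := hx
    obtain ⟨K', hK', h2⟩ := hy
    refine ⟨K + K' * ENNReal.ofReal (ω x), by finiteness, fun w => ?_⟩
    calc vari X τ w (x * y) ≤ vari X τ w x + vari X τ (w * x) y := by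
          unfold vari
          rw [← ENNReal.tsum_add]
          refine ENNReal.tsum_le_tsum fun n => ?_
          rw [← mul_add, ← mul_assoc w x y]
          gcongr
          have : phi X n (w * x * y) - phi X n w =
            (phi X n (w * x) - phi X n w) + (phi X n (w * x * y) - phi X n (w * x)) := by ring
          rw [this]
          exact enorm_add_le _ _
      _ ≤ K * ENNReal.ofReal (ω w) + K' * ENNReal.ofReal (ω (w * x)) := add_le_add (h1 _) (h2 _)
      _ ≤ K * ENNReal.ofReal (ω w) + K' * (ENNReal.ofReal (ω w) * ENNReal.ofReal (ω x)) := by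
          rw [← ENNReal.ofReal_mul (wpos hω w).le]
          gcongr
          exact hω.2.2 w x
      _ = _ := by ring
  | inv x _ hx =>
    obtain ⟨K, hK, h1⟩ := hx
    refine ⟨K * ENNReal.ofReal (ω x⁻¹), by finiteness, fun w => ?_⟩
    calc vari X τ w x⁻¹ = vari X τ (w * x⁻¹) x := by
          unfold vari
          refine tsum_congr fun n => ?_
          rw [inv_mul_cancel_right, ← enorm_neg, neg_sub]
      _ ≤ K * ENNReal.ofReal (ω (w * x⁻¹)) := h1 _
      _ ≤ K * (ENNReal.ofReal (ω w) * ENNReal.ofReal (ω x⁻¹)) := by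
          rw [← ENNReal.ofReal_mul (wpos hω w).le]
          gcongr
          exact hω.2.2 w _
      _ = _ := by ring

lemma phi_sum (hω : IsWeight ω) {a y : G → ℂ} (ha : a ∈ l1w ω) (hy : y ∈ l1w0 ω) (S : Finset G)
    (hS : ∀ t, t ∉ S → y t = 0) (n : ℕ) :
    HasSum (fun v => phi X n v * ∑' s, a s * y (s⁻¹ * v))
      (∑ t ∈ S, y t * ∑' w, a w * (phi X n (w * t) - phi X n w)) := by
  have h1 : ∀ v, ∑' s, a s * y (s⁻¹ * v) = ∑ t ∈ S, a (v * t⁻¹) * y t := by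
    intro v
    rw [← ((Equiv.inv G).trans (Equiv.mulLeft v)).tsum_eq]
    rw [tsum_eq_sum (s := S)]
    · simp
    · intro t ht
      simp [hS t ht]
  have hs : ∀ t, Summable fun w => a w * phi X n (w * t) := by
    intro t
    refine Summable.of_norm_bounded (l1w_summable hω ha) fun w => ?_
    rw [norm_mul]
    exact mul_le_of_le_one_right (norm_nonneg _) (phi_norm_le _ _)
  have hs0 : Summable fun w => a w * phi X n w := by simpa using hs 1
  have hy0 : ∑ t ∈ S, y t = 0 := by
    rw [← hy.2, tsum_eq_sum (s := S)]
    exact fun t ht => hS t ht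
  have h2 : ∑ t ∈ S, y t * ∑' w, a w * (phi X n (w * t) - phi X n w) =
      ∑ t ∈ S, y t * ∑' w, a w * phi X n (w * t) := by
    have : ∀ t, ∑' w, a w * (phi X n (w * t) - phi X n w) =
        (∑' w, a w * phi X n (w * t)) - ∑' w, a w * phi X n w := fun t => by
      rw [← (hs t).tsum_sub hs0]
      exact tsum_congr fun w => by ring
    simp only [this]
    simp only [mul_sub, Finset.sum_sub_distrib, ← Finset.sum_mul, hy0]
    ring
  rw [h2]
  simp only [h1, Finset.mul_sum]
  refine hasSum_sum fun t _ => ?_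
  rw [← (Equiv.mulRight t).hasSum_iff]
  refine ((hs t).hasSum.mul_left (y t)).congr_fun fun w => ?_
  simp
  ring

lemma fwd [Infinite G] (hXsym : ∀ x ∈ X, x⁻¹ ∈ X) (hXgen : Subgroup.closure (X : Set G) = ⊤)
    (hω : IsWeight ω)
    (hτ : ∀ (n : ℕ) (u : G), wordLength (X : Set G) u = n + 1 → τ n = ω u)
    (h : IsFinGenLeftIdealOf ω (l1w0 ω)) : TailPreserving τ := by
  classical
  obtain ⟨N, y, hy1, hy2, hy3⟩ := fg_fin hω h
  intro x hx
  choose p hp using fun n : ℕ => wl_surj hXsym hXgen (n + 1)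
  have hpinj : Function.Injective p := by
    intro m n hmn
    have := hp m
    rw [hmn, hp n] at this
    omega
  have hτp : ∀ n, τ n = ω (p n) := fun n => hτ n (p n) (hp n)
  have hτ1 : ∀ n, 1 ≤ τ n := fun n => by rw [hτp]; exact hω.1 _
  have hτ0 : ∀ n, 0 ≤ τ n := fun n => zero_le_one.trans (hτ1 n)
  have hxs : Summable fun n => ‖x n‖ :=
    Summable.of_nonneg_of_le (fun _ => norm_nonneg _)
      (fun n => le_mul_of_one_le_left (norm_nonneg _) (hτ1 n)) hx
  set c := ∑' n, x n with hc
  let g : G → ℂ := Function.extend p x 0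
  let δ : G → ℂ := fun u => if u = 1 then c else 0
  have hg : ∀ h : G → ℂ, (fun v => h v * g v) = Function.extend p (fun n => h (p n) * x n) 0 := by
    intro h
    funext v
    by_cases hv : ∃ n, p n = v
    · obtain ⟨n, rfl⟩ := hv
      simp only [g]
      rw [hpinj.extend_apply, hpinj.extend_apply]
    · simp only [g]
      rw [Function.extend_apply' _ _ _ hv, Function.extend_apply' _ _ _ hv]
      simp
  have hgl : g ∈ l1w ω := by
    have h1 : (fun v => ‖g v‖ * ω v) = Function.extend p (fun n => τ n * ‖x n‖) 0 := by
      funext v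
      by_cases hv : ∃ n, p n = v
      · obtain ⟨n, rfl⟩ := hv
        simp only [g]
        rw [hpinj.extend_apply, hpinj.extend_apply, hτp, mul_comm]
      · simp only [g]
        rw [Function.extend_apply' _ _ _ hv, Function.extend_apply' _ _ _ hv]
        simp
    show Summable (fun v => ‖g v‖ * ω v)
    rw [h1]
    exact (summable_extend_zero hpinj).2 hx
  have hδl : δ ∈ l1w ω := by
    refine fin_l1w ((Set.finite_singleton (1 : G)).subset fun u hu => ?_)
    by_contra h
    have h : u ≠ 1 := h
    exact hu (by simp [δ, h])
  have hf : g - δ ∈ l1w0 ω := by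
    refine ⟨l1w_sub hω hgl hδl, ?_⟩
    have h1 : HasSum g c := (hasSum_extend_zero hpinj).2 hxs.of_norm.hasSum
    have h2 : HasSum δ c := hasSum_ite_eq 1 c
    have := (h1.sub h2).tsum_eq
    rw [sub_self] at this
    exact this
  have htail : ∀ n, HasSum (fun v => phi X n v * (g - δ) v) (tailFrom x n) := by
    intro n
    have h1 : (fun v => phi X n v * (g - δ) v) = fun v => phi X n v * g v := by
      funext v
      by_cases hv : v = 1
      · subst hv
        simp [phi, wl_one]
      · simp [δ, hv]
    rw [h1, hg, hasSum_extend_zero hpinj]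
    have h2 : ∀ m, phi X n (p m) * x m = if n < m then x m else 0 := by
      intro m
      simp only [phi, hp]
      by_cases h : n < m <;> simp [h]
    simp only [h2]
    have h3 : Summable fun m => if n < m then x m else 0 :=
      Summable.of_norm_bounded hxs fun m => by split_ifs <;> simp
    have h4 : tailFrom x n = ∑' m, if n < m then x m else 0 := by
      unfold tailFrom
      rw [← Function.Injective.tsum_eq (g := fun j => n + 1 + j)
        (f := fun m => if n < m then x m else 0) (fun a b hab => by simpa using hab)]
      · refine tsum_congr fun j => ?_
        rw [if_pos (by omega)]
      · intro m hm
        rw [Function.mem_support] at hm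
        have : n < m := by
          by_contra hh
          exact hm (if_neg hh)
        exact ⟨m - (n + 1), by simp; omega⟩
    rw [h4]
    exact h3.hasSum
  obtain ⟨a, ha, hfa⟩ := hy3 _ hf
  let S : Fin N → Finset G := fun i => (hy2 i).toFinset
  have hS : ∀ i t, t ∉ S i → y i t = 0 := by
    intro i t ht
    by_contra h
    exact ht ((hy2 i).mem_toFinset.2 h)
  have htail2 : ∀ n, tailFrom x n =
      ∑ i, ∑ t ∈ S i, y i t * ∑' w, a i w * (phi X n (w * t) - phi X n w) := by
    intro n
    refine (htail n).unique ?_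
    simp only [hfa, Finset.mul_sum]
    exact hasSum_sum fun i _ => phi_sum hω (ha i) (hy1 i) (S i) (hS i) n
  choose K hK1 hK2 using vari_bound hXsym hXgen hω hτ
  rw [summable_iff_enn (fun n => mul_nonneg (hτ0 n) (norm_nonneg _))]
  have hterm : ∀ n, ENNReal.ofReal (τ n * ‖tailFrom x n‖) ≤
      ∑ i, ∑ t ∈ S i, ∑' w, ‖y i t‖ₑ * (‖a i w‖ₑ *
        (ENNReal.ofReal (τ n) * ‖phi X n (w * t) - phi X n w‖ₑ)) := by
    intro n
    rw [mul_comm, ofReal_norm_mul, mul_comm, htail2]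
    calc _ ≤ ENNReal.ofReal (τ n) * ∑ i, ∑ t ∈ S i, ‖y i t‖ₑ * ∑' w, ‖a i w‖ₑ *
            ‖phi X n (w * t) - phi X n w‖ₑ := by
          gcongr
          refine (enorm_sum_le _ _).trans (Finset.sum_le_sum fun i _ => ?_)
          refine (enorm_sum_le _ _).trans (Finset.sum_le_sum fun t _ => ?_)
          rw [enorm_mul]
          gcongr
          refine enorm_tsum_le_tsum_enorm.trans (le_of_eq ?_)
          simp [enorm_mul]
      _ = _ := by
          simp only [Finset.mul_sum, ← ENNReal.tsum_mul_left]
          refine Finset.sum_congr rfl fun i _ => Finset.sum_congr rfl fun t _ =>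
            tsum_congr fun w => by ring
  refine ne_top_of_le_ne_top ?_ (ENNReal.tsum_le_tsum hterm)
  rw [Summable.tsum_finsetSum (fun _ _ => ENNReal.summable)]
  refine (ENNReal.sum_lt_top.2 fun i _ => ?_).ne
  rw [Summable.tsum_finsetSum (fun _ _ => ENNReal.summable)]
  refine ENNReal.sum_lt_top.2 fun t _ => ?_
  rw [ENNReal.tsum_comm]
  have ha' := (summable_iff_enn (fun u => mul_nonneg (norm_nonneg _) (wpos hω u).le)).1 (ha i)
  simp only [ofReal_norm_mul] at ha'
  calc _ = ‖y i t‖ₑ * ∑' w, ‖a i w‖ₑ * vari X τ w t := by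
        simp only [ENNReal.tsum_mul_left, vari]
    _ ≤ ‖y i t‖ₑ * ∑' w, ‖a i w‖ₑ * (K t * ENNReal.ofReal (ω w)) := by
        gcongr with w
        exact hK2 t w
    _ = ‖y i t‖ₑ * (K t * ∑' w, ‖a i w‖ₑ * ENNReal.ofReal (ω w)) := by
        rw [← ENNReal.tsum_mul_left (a := K t)]
        congr 1
        exact tsum_congr fun w => by ring
    _ < ⊤ := by
        have := hK1 t
        exact ENNReal.mul_lt_top enorm_lt_top (ENNReal.mul_lt_top this.lt_top ha'.lt_top)

end Fwd
section Bwd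

open scoped ENNReal

variable [Group G] {X : Finset G} {ω : G → ℝ} {τ : ℕ → ℝ}

lemma mem_l1w_iff (hω : IsWeight ω) (f : G → ℂ) :
    f ∈ l1w ω ↔ ∑' u, ‖f u‖ₑ * ENNReal.ofReal (ω u) ≠ ⊤ := by
  have := summable_iff_enn (f := fun u => ‖f u‖ * ω u)
    (fun u => mul_nonneg (norm_nonneg _) (wpos hω u).le)
  simp only [ofReal_norm_mul] at this
  exact this

/-- values of the weight on spheres, starting from radius zero -/
def sg (τ : ℕ → ℝ) : ℕ → ℝ≥0∞
  | 0 => 1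
  | k + 1 => ENNReal.ofReal (τ k)

lemma sg_eq (hXsym : ∀ x ∈ X, x⁻¹ ∈ X) (hXgen : Subgroup.closure (X : Set G) = ⊤)
    (hω : IsWeight ω)
    (hτ : ∀ (n : ℕ) (u : G), wordLength (X : Set G) u = n + 1 → τ n = ω u) (u : G) :
    sg τ (wordLength (X : Set G) u) = ENNReal.ofReal (ω u) := by
  rcases h : wordLength (X : Set G) u with _ | k
  · rw [wl_eq_zero hXsym hXgen u h, hω.2.1]; simp [sg]
  · rw [← hτ k u h]; rfl

open Classical in
lemma path (hXsym : ∀ x ∈ X, x⁻¹ ∈ X) (hXgen : Subgroup.closure (X : Set G) = ⊤)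
    (hω : IsWeight ω)
    (hτ : ∀ (n : ℕ) (u : G), wordLength (X : Set G) u = n + 1 → τ n = ω u) (n : ℕ) :
    ∀ u, wordLength (X : Set G) u = n → ∃ b : G → G → ℂ,
      (∀ x, ∑' v, ‖b x v‖ₑ * ENNReal.ofReal (ω v) ≤ ∑ k ∈ Finset.range n, sg τ k) ∧
      ∀ v, ∑ x ∈ X, (b x (v * x⁻¹) - b x v) =
        (if v = u then 1 else 0) - (if v = 1 then 1 else 0) := by
  induction n with
  | zero =>
    intro u hu
    rw [wl_eq_zero hXsym hXgen u hu]
    exact ⟨fun _ _ => 0, by simp, by simp⟩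
  | succ n ih =>
    intro u hu
    obtain ⟨w, y, hy, rfl, hw⟩ := wl_parent hXsym hXgen u n hu
    obtain ⟨b, hb1, hb2⟩ := ih w hw
    refine ⟨fun x v => b x v + if x = y then (if v = w then 1 else 0) else 0, fun x => ?_,
      fun v => ?_⟩
    · rw [Finset.sum_range_succ]
      have h1 : sg τ n = ∑' v, if v = w then ENNReal.ofReal (ω w) else 0 := by
        rw [tsum_ite_eq w (fun _ => ENNReal.ofReal (ω w)), ← sg_eq hXsym hXgen hω hτ w, hw]
      refine le_trans ?_ (add_le_add (hb1 x) h1.ge)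
      rw [← ENNReal.tsum_add]
      refine ENNReal.tsum_le_tsum fun v => ?_
      refine (mul_le_mul_left (enorm_add_le _ _) _).trans ?_
      rw [add_mul]
      refine add_le_add le_rfl ?_
      by_cases h1 : x = y <;> by_cases h2 : v = w <;> simp [h1, h2]
    · have : ∀ x, (b x (v * x⁻¹) + (if x = y then (if v * x⁻¹ = w then (1 : ℂ) else 0) else 0)) -
          (b x v + if x = y then (if v = w then 1 else 0) else 0) =
          (b x (v * x⁻¹) - b x v) + if x = y then ((if v * y⁻¹ = w then (1 : ℂ) else 0) -
            (if v = w then 1 else 0)) else 0 := by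
        intro x
        by_cases h : x = y
        · subst h; simp only [if_true]; ring
        · simp [h]
      simp only [this, Finset.sum_add_distrib, hb2]
      rw [Finset.sum_ite_eq' X y, if_pos hy]
      simp only [mul_inv_eq_iff_eq_mul]
      ring

lemma tail_cost (hω : IsWeight ω)
    (hτ : ∀ (n : ℕ) (u : G), wordLength (X : Set G) u = n + 1 → τ n = ω u)
    (hτ0 : ∀ n, 1 ≤ τ n)
    (hT : TailPreserving τ) {f : G → ℂ} (hf : f ∈ l1w ω) :
    ∑' u, ‖f u‖ₑ * ∑ k ∈ Finset.range (wordLength (X : Set G) u), sg τ k ≠ ⊤ := by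
  classical
  set L := wordLength (X : Set G) with hL
  let Y : ℕ → ℝ≥0∞ := fun n => ∑' u, if L u = n + 1 then ‖f u‖ₑ else 0
  have hfs : ∑' u, ‖f u‖ₑ ≠ ⊤ := by
    refine ne_top_of_le_ne_top ((mem_l1w_iff hω f).1 hf) (ENNReal.tsum_le_tsum fun u => ?_)
    refine le_mul_of_one_le_right (zero_le) ?_
    simpa using hω.1 u
  have hYt : ∀ n, Y n ≠ ⊤ := fun n =>
    ne_top_of_le_ne_top hfs (ENNReal.tsum_le_tsum fun u => by split_ifs <;> simp)
  have hYτ : ∑' n, ENNReal.ofReal (τ n) * Y n ≠ ⊤ := by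
    refine ne_top_of_le_ne_top ((mem_l1w_iff hω f).1 hf) ?_
    simp only [Y, ← ENNReal.tsum_mul_left]
    rw [ENNReal.tsum_comm]
    refine ENNReal.tsum_le_tsum fun u => ?_
    rcases h : L u with _ | m
    · simp
    · rw [tsum_eq_single m (fun n hn => by simp [hn.symm])]
      simp [hτ m u h, mul_comm]
  let x : ℕ → ℂ := fun n => ((Y n).toReal : ℂ)
  have hxe : ∀ n, ‖x n‖ = (Y n).toReal := fun n => by
    simp [x, abs_of_nonneg]
  have hx : Summable fun n => τ n * ‖x n‖ := by
    rw [summable_iff_enn (fun n => mul_nonneg (zero_le_one.trans (hτ0 n)) (norm_nonneg _))]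
    convert hYτ using 3 with n
    rw [ENNReal.ofReal_mul (zero_le_one.trans (hτ0 n)), hxe, ENNReal.ofReal_toReal (hYt n)]
  have hYs : ∑' n, Y n ≠ ⊤ := by
    refine ne_top_of_le_ne_top hYτ (ENNReal.tsum_le_tsum fun n => ?_)
    refine le_mul_of_one_le_left (zero_le) ?_
    simpa using hτ0 n
  have hxt : ∀ n, ENNReal.ofReal ‖tailFrom x n‖ = ∑' j, Y (n + 1 + j) := by
    intro n
    have h1 : tailFrom x n = ((∑' j, (Y (n + 1 + j)).toReal : ℝ) : ℂ) := by
      unfold tailFrom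
      rw [Complex.ofReal_tsum]
    have h2 : ∑' j, Y (n + 1 + j) ≠ ⊤ :=
      ne_top_of_le_ne_top hYs (ENNReal.tsum_comp_le_tsum_of_injective
        (f := fun j => n + 1 + j) (fun a b hab => by simpa using hab) Y)
    rw [h1, Complex.norm_real, Real.norm_of_nonneg (tsum_nonneg fun _ => ENNReal.toReal_nonneg),
      ← ENNReal.tsum_toReal_eq (fun _ => hYt _), ENNReal.ofReal_toReal h2]
  have hfin := hT x hx
  rw [summable_iff_enn (fun n => mul_nonneg (zero_le_one.trans (hτ0 n)) (norm_nonneg _))] at hfin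
  have hmain : ∑' u, ‖f u‖ₑ * ∑ k ∈ Finset.range (L u), sg τ k ≤
      (∑' u, ‖f u‖ₑ) + ∑' n, ENNReal.ofReal (τ n * ‖tailFrom x n‖) := by
    have h1 : ∀ n, ENNReal.ofReal (τ n * ‖tailFrom x n‖) =
        ∑' u, ENNReal.ofReal (τ n) * ∑' j, if L u = (n + 1 + j) + 1 then ‖f u‖ₑ else 0 := by
      intro n
      rw [ENNReal.ofReal_mul (zero_le_one.trans (hτ0 n)), hxt, ENNReal.tsum_mul_left,
        ENNReal.tsum_comm]
    simp only [h1]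
    rw [ENNReal.tsum_comm, ← ENNReal.tsum_add]
    refine ENNReal.tsum_le_tsum fun u => ?_
    have h2 : ∀ n, n + 1 < L u →
        ‖f u‖ₑ ≤ ∑' j, if L u = (n + 1 + j) + 1 then ‖f u‖ₑ else 0 := by
      intro n hn
      refine le_trans ?_ (ENNReal.le_tsum (L u - (n + 2)))
      rw [if_pos (by omega)]
    rcases hm : L u with _ | m
    · simp
    · rw [Finset.sum_range_succ', mul_add, add_comm]
      refine add_le_add (by simp [sg]) ?_
      rw [Finset.mul_sum]
      refine le_trans (Finset.sum_le_sum fun k hk => ?_) (ENNReal.sum_le_tsum (Finset.range m))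
      have hk' := Finset.mem_range.1 hk
      have := h2 k (by omega)
      rw [hm] at this
      rw [mul_comm]
      exact mul_le_mul_right this (ENNReal.ofReal (τ k))
  exact ne_top_of_le_ne_top (ENNReal.add_ne_top.2 ⟨hfs, hfin⟩) hmain

open Classical in
/-- the standard generators -/
def gen (x : G) : G → ℂ := fun v => (if v = x then 1 else 0) - (if v = 1 then 1 else 0)

lemma gen_fin (x : G) : (gen x).support.Finite := by
  refine ((Set.finite_singleton (1 : G)).union (Set.finite_singleton x)).subset fun u hu => ?_
  by_contra h
  simp only [Set.mem_union, Set.mem_singleton_iff, not_or] at h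
  exact hu (by simp [gen, h.1, h.2])

lemma gen_mem (x : G) : gen x ∈ l1w0 ω := by
  classical
  refine ⟨fin_l1w (gen_fin x), ?_⟩
  have h1 : HasSum (fun v : G => if v = x then (1 : ℂ) else 0) 1 := hasSum_ite_eq x 1
  have h2 : HasSum (fun v : G => if v = 1 then (1 : ℂ) else 0) 1 := hasSum_ite_eq 1 1
  have := (h1.sub h2).tsum_eq
  rw [sub_self] at this
  rw [← this]
  exact tsum_congr fun u => by unfold gen; congr

lemma conv_gen (a : G → ℂ) (x : G) : conv a (gen x) = fun u => a (u * x⁻¹) - a u := by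
  classical
  funext u
  rw [conv_apply]
  have h1 := (hasSum_ite_eq (u * x⁻¹) (a (u * x⁻¹))).sub (hasSum_ite_eq u (a u))
  refine HasSum.tsum_eq (h1.congr_fun fun s => ?_)
  have e1 : s⁻¹ * u = x ↔ s = u * x⁻¹ := by
    rw [inv_mul_eq_iff_eq_mul, eq_mul_inv_iff_mul_eq, eq_comm]
  have e2 : s⁻¹ * u = 1 ↔ s = u := by
    rw [inv_mul_eq_one]
  simp only [gen, e1, e2]
  have f1 : a s * (if s = u * x⁻¹ then 1 else 0) =
      if s = u * x⁻¹ then a (u * x⁻¹) else 0 := by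
    split_ifs with h
    · rw [h, mul_one]
    · simp
  have f2 : a s * (if s = u then 1 else 0) = if s = u then a u else 0 := by
    split_ifs with h
    · rw [h, mul_one]
    · simp
  rw [mul_sub, f1, f2]

lemma conv_gen_mem (hω : IsWeight ω) {a : G → ℂ} (ha : a ∈ l1w ω) (x : G) :
    conv a (gen x) ∈ l1w0 ω := by
  rw [conv_gen]
  have h1 : (fun u => a (u * x⁻¹)) ∈ l1w ω := by
    show Summable _
    rw [← (Equiv.mulRight x).summable_iff]
    refine Summable.of_nonneg_of_le (fun u => mul_nonneg (norm_nonneg _) (wpos hω _).le)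
      (fun u => ?_) (Summable.mul_right (ω x) ha)
    simp only [Function.comp, Equiv.coe_mulRight, mul_inv_cancel_right]
    rw [mul_assoc]
    exact mul_le_mul_of_nonneg_left (hω.2.2 u x) (norm_nonneg _)
  refine ⟨l1w_sub hω h1 ha, ?_⟩
  rw [(l1w_summable hω h1).of_norm.tsum_sub (l1w_summable hω ha).of_norm,
    sub_eq_zero]
  exact (Equiv.mulRight x⁻¹).tsum_eq a

lemma l1w0_add (hω : IsWeight ω) {x y : G → ℂ} (hx : x ∈ l1w0 ω) (hy : y ∈ l1w0 ω) :
    x + y ∈ l1w0 ω := by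
  have h0 : (0 : G → ℂ) ∈ l1w0 ω := ⟨fin_l1w (by simp), by simp⟩
  have := l1w0_sub hω hx (l1w0_sub hω h0 hy)
  simpa using this

lemma bwd (hXsym : ∀ x ∈ X, x⁻¹ ∈ X) (hXgen : Subgroup.closure (X : Set G) = ⊤)
    (hω : IsWeight ω)
    (hτ : ∀ (n : ℕ) (u : G), wordLength (X : Set G) u = n + 1 → τ n = ω u)
    (hτ0 : ∀ n, 1 ≤ τ n)
    (hT : TailPreserving τ) : IsFinGenLeftIdealOf ω (l1w0 ω) := by
  classical
  let e : Fin X.card ≃ X := X.equivFin.symm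
  refine ⟨X.card, fun i => gen (e i : G), fun i => (gen_mem (ω := ω) _).1, ?_⟩
  ext f
  constructor
  · intro hf
    choose b hb1 hb2 using fun u => path hXsym hXgen hω hτ _ u rfl
    have hcost := tail_cost hω hτ hτ0 hT hf.1
    let a : G → G → ℂ := fun x v => ∑' u, f u * b u x v
    have ha : ∀ x, a x ∈ l1w ω := by
      intro x
      rw [mem_l1w_iff hω]
      refine ne_top_of_le_ne_top hcost ?_
      calc _ ≤ ∑' v, (∑' u, ‖f u‖ₑ * ‖b u x v‖ₑ) * ENNReal.ofReal (ω v) := by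
            refine ENNReal.tsum_le_tsum fun v => mul_le_mul_left ?_ _
            refine enorm_tsum_le_tsum_enorm.trans (le_of_eq ?_)
            simp [enorm_mul]
        _ = ∑' u, ‖f u‖ₑ * ∑' v, ‖b u x v‖ₑ * ENNReal.ofReal (ω v) := by
            simp only [← ENNReal.tsum_mul_right, ← ENNReal.tsum_mul_left]
            rw [ENNReal.tsum_comm]
            simp only [mul_assoc]
        _ ≤ _ := ENNReal.tsum_le_tsum fun u => mul_le_mul_right (hb1 u x) _
    have hsum : ∀ x v, Summable fun u => f u * b u x v := by
      intro x v
      apply Summable.of_norm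
      rw [summable_iff_enn (fun _ => norm_nonneg _)]
      refine ne_top_of_le_ne_top hcost (ENNReal.tsum_le_tsum fun u => ?_)
      rw [ofReal_norm, enorm_mul]
      refine mul_le_mul_right ((le_trans ?_ (ENNReal.le_tsum v)).trans (hb1 u x)) _
      refine le_mul_of_one_le_right (zero_le) ?_
      simpa using hω.1 v
    refine ⟨fun i => a (e i), fun _ => 0, fun i => ha _, ?_⟩
    funext v
    simp only [zero_smul, add_zero, conv_gen, Finset.sum_apply]
    rw [e.sum_comp (fun x : X => a x (v * (x : G)⁻¹) - a x v),
      Finset.sum_coe_sort X (fun x => a x (v * x⁻¹) - a x v)]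
    have h1 : HasSum (fun u => ∑ x ∈ X, (f u * b u x (v * x⁻¹) - f u * b u x v))
        (∑ x ∈ X, (a x (v * x⁻¹) - a x v)) :=
      hasSum_sum fun x _ => (hsum x _).hasSum.sub (hsum x _).hasSum
    have h0 : HasSum f 0 := by
      rw [← hf.2]; exact (l1w_summable hω hf.1).of_norm.hasSum
    have h2 : HasSum (fun u => (if u = v then f v else 0) - f u * (if v = 1 then 1 else 0))
        (f v - 0 * (if v = 1 then 1 else 0)) := (hasSum_ite_eq v (f v)).sub (h0.mul_right _)
    rw [zero_mul, sub_zero] at h2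
    refine h2.unique (h1.congr_fun fun u => ?_)
    simp only [← mul_sub, ← Finset.mul_sum]
    rw [hb2, mul_sub]
    congr 1
    by_cases h : u = v
    · subst h; simp
    · have h' : v ≠ u := fun hh => h hh.symm
      simp [h, h']
  · rintro ⟨a, c, ha, rfl⟩
    refine Finset.sum_induction _ (· ∈ l1w0 ω) (fun x y hx hy => l1w0_add hω hx hy)
      ⟨fin_l1w (by simp), by simp⟩ fun i _ => l1w0_add hω (conv_gen_mem hω (ha i) _) ?_
    refine ⟨fin_l1w ((gen_fin (e i : G)).subset fun u hu => ?_), ?_⟩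
    · intro h
      exact hu (by simp [h])
    · have := (gen_mem (ω := ω) (e i : G)).2
      simp only [Pi.smul_apply, smul_eq_mul]
      rw [tsum_mul_left, this, mul_zero]

end Bwd

/-- Theorem 1.6: let `G` be an infinite, finitely-generated group with finite symmetric
generating set `X`, let `ω` be a radial weight on `G` with respect to `X`, and let
`τ n` be the value that `ω` takes on the sphere `S_{n+1} = {u : |u| = n+1}` (0-indexed).
Then `ℓ¹₀(G, ω)` is finitely generated as a left ideal of `ℓ¹(G, ω)` if and only if
`(τₙ)` is tail-preserving. -/
theorem stmt10 [Group G] [Infinite G] (X : Finset G)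
    (hXsym : ∀ x ∈ X, x⁻¹ ∈ X) (hXgen : Subgroup.closure (X : Set G) = ⊤)
    (ω : G → ℝ) (hω : IsWeight ω)
    (hradial : ∀ u v : G, wordLength (X : Set G) u = wordLength (X : Set G) v → ω u = ω v)
    (τ : ℕ → ℝ) (hτ : ∀ (n : ℕ) (u : G), wordLength (X : Set G) u = n + 1 → τ n = ω u) :
    IsFinGenLeftIdealOf ω (l1w0 ω) ↔ TailPreserving τ := by
  have hτ0 : ∀ n, 1 ≤ τ n := fun n => by
    obtain ⟨u, hu⟩ := wl_surj hXsym hXgen (n + 1)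
    rw [hτ n u hu]; exact hω.1 u
  exact ⟨fwd hXsym hXgen hω hτ, bwd hXsym hXgen hω hτ hτ0⟩
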